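/- If a full moment sequence s on ℝⁿ is indeterminate (admits at least two distinct representing measures), then for every t ≥ 0 the heat-evolved sequence 𝔭_s(t) is indeterminate. Equivalently, if 𝔭_s(t) is determinate for some t ≥ 0, then s is determinate. -/

import Mathlib

open Finset MeasureTheory

/-- The heat moment polynomials (explicit solution of the heat moment recursion). -/
noncomputable def fp {n : ℕ} (s : (Fin n → ℕ) → ℝ) (t : ℝ) (α : Fin n → ℕ) : ℝ :=
  ∑ β : (∀ i : Fin n, Fin (α i / 2 + 1)),
    (∏ i, ((α i).factorial : ℝ) /
        (((α i - 2 * (β i : ℕ)).factorial : ℝ) * (((β i : ℕ)).factorial : ℝ))) *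
      s (fun i => α i - 2 * (β i : ℕ)) * t ^ (∑ i, (β i : ℕ))

/-- `μ` represents the full moment sequence `s` on `ℝⁿ`. -/
def Represents {n : ℕ} (μ : Measure (Fin n → ℝ)) (s : (Fin n → ℕ) → ℝ) : Prop :=
  ∀ α : Fin n → ℕ,
    Integrable (fun x : Fin n → ℝ => ∏ i, x i ^ α i) μ ∧
    s α = ∫ x : Fin n → ℝ, ∏ i, x i ^ α i ∂μ

/-- A full moment sequence is indeterminate if it admits two distinct representing measures. -/
def Indeterminate {n : ℕ} (s : (Fin n → ℕ) → ℝ) : Prop :=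
  ∃ μ ν : Measure (Fin n → ℝ), Represents μ s ∧ Represents ν s ∧ μ ≠ ν

section Aux

open ProbabilityTheory
open scoped MeasureTheory
open MeasureTheory.Measure

lemma gm_rec (t : ℝ) (k : ℕ) : iteratedDeriv (k+2) (fun u : ℝ => Real.exp (t*u^2)) = fun u => 
   2*t*u* iteratedDeriv (k+1) (fun u : ℝ => Real.exp (t*u^2)) u + 2*t*(k+1)*iteratedDeriv k (fun u : ℝ => Real.exp (t*u^2)) u := by
  have hM : ContDiff ℝ ⊤ (fun u : ℝ => Real.exp (t*u^2)) := by fun_prop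
  have hd : ∀ k, Differentiable ℝ (iteratedDeriv k (fun u : ℝ => Real.exp (t*u^2))) := fun k =>
    hM.differentiable_iteratedDeriv k (by exact_mod_cast WithTop.coe_lt_top _)
  induction k with
  | zero =>
    have h1 : iteratedDeriv 1 (fun u : ℝ => Real.exp (t*u^2)) = fun u => 2*t*u*Real.exp (t*u^2) := by
      rw [iteratedDeriv_one]; ext u
      have := (((hasDerivAt_id u).pow 2).const_mul t).exp
      simp only [id, Pi.pow_apply] at this
      rw [this.deriv]; simp; ring
    rw [iteratedDeriv_succ]
    ext u
    have := ((hasDerivAt_id u).const_mul (2*t)).mul ((hd 0) u).hasDerivAt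
    have e : (iteratedDeriv (0+1) (fun u : ℝ => Real.exp (t*u^2))) = (fun u => 2*t*u) * (iteratedDeriv 0 (fun u : ℝ => Real.exp (t*u^2))) := by
      simp only [zero_add, h1]; ext u; simp
    conv_lhs => rw [e]
    refine this.deriv.trans ?_
    rw [← iteratedDeriv_succ]; simp; ring
  | succ k ih =>
    rw [iteratedDeriv_succ]
    ext u
    conv_lhs => rw [ih]
    have := (((hasDerivAt_id u).const_mul (2*t)).mul ((hd (k+1)) u).hasDerivAt).add (((hd k) u).hasDerivAt.const_mul (2*t*(k+1)))
    refine this.deriv.trans ?_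
    rw [← iteratedDeriv_succ, ← iteratedDeriv_succ]; simp; ring

lemma gm_int (v : NNReal) (k : ℕ) : Integrable (fun x : ℝ => x^k) (gaussianReal 0 v) :=
  integrable_pow_of_mem_interior_integrableExpSet (X := fun x => x) (by
    have := integrableExpSet_id_gaussianReal (μ := 0) (v := v)
    rw [show (fun x : ℝ => x) = id from rfl, this]; simp) k

lemma gm_eq (v : NNReal) (k : ℕ) : ∫ x, x^k ∂(gaussianReal 0 v) = iteratedDeriv k (fun u : ℝ => Real.exp ((v/2)*u^2)) 0 := by
  have := iteratedDeriv_mgf_zero (X := id) (μ := gaussianReal 0 v) (by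
    rw [integrableExpSet_id_gaussianReal]; simp) k
  rw [mgf_id_gaussianReal] at this
  simp at this
  rw [← this]; congr 1; ext u; congr 1; ring

lemma gm_odd (v : NNReal) (j : ℕ) : ∫ x, x^(2*j+1) ∂(gaussianReal 0 v) = 0 := by
  induction j with
  | zero => simp
  | succ j ih =>
    rw [gm_eq] at *
    rw [show 2*(j+1)+1 = (2*j+1)+2 by ring, gm_rec]; simp [ih]

lemma gm_even (v : NNReal) (j : ℕ) : ∫ x, x^(2*j) ∂(gaussianReal 0 v) = (v/2)^j * (2*j).factorial / j.factorial := by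
  induction j with
  | zero => simp
  | succ j ih =>
    rw [gm_eq] at *
    rw [show 2*(j+1) = (2*j)+2 by ring, gm_rec]; simp only [ih]
    simp only [Nat.factorial_succ]; push_cast; field_simp; ring

lemma sum_even (m : ℕ) (g : ℕ → ℝ) (h : ∀ j, g (2*j+1) = 0) :
    ∑ k ∈ range (m+1), g k = ∑ j : Fin (m/2+1), g (2*(j:ℕ)) := by
  rw [Fin.sum_univ_eq_sum_range (fun j => g (2*j))]
  rw [← Finset.sum_image (s := range (m/2+1)) (g := fun j => 2*j) (f := g) (by intro a _ b _ h; simpa using h)]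
  symm
  apply Finset.sum_subset
  · intro k hk; simp at *; omega
  · intro k hk hk2
    rcases Nat.even_or_odd' k with ⟨j, rfl | rfl⟩
    · exfalso; apply hk2; simp at *; omega
    · exact h j

lemma oneD (v : NNReal) (x : ℝ) (m : ℕ) : ∫ y, (x+y)^m ∂(gaussianReal 0 v) =
    ∑ j : Fin (m/2+1), ((m.factorial : ℝ) / (((m - 2 * (j : ℕ)).factorial : ℝ) * ((j : ℕ).factorial : ℝ))) *
      x ^ (m - 2*(j:ℕ)) * (v/2 : ℝ)^(j:ℕ) := by
  have e : ∀ y : ℝ, (x+y)^m = ∑ k ∈ range (m+1), (x^(m-k) * (m.choose k)) * y^k := by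
    intro y; rw [add_comm, add_pow]; refine Finset.sum_congr rfl fun k _ => by ring
  simp_rw [e]
  rw [integral_finsetSum _ (fun k _ => (gm_int v k).const_mul _)]
  simp_rw [integral_const_mul]
  rw [sum_even _ _ (fun j => by rw [gm_odd]; simp)]
  refine Finset.sum_congr rfl fun j _ => ?_
  have hj : 2*(j:ℕ) ≤ m := by have := j.2; omega
  rw [gm_even, Nat.cast_choose ℝ hj]
  have := Nat.factorial_ne_zero (2*(j:ℕ))
  field_simp

lemma fp_represents {n : ℕ} {s : (Fin n → ℕ) → ℝ} {μ : Measure (Fin n → ℝ)} [IsFiniteMeasure μ]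
    (h : Represents μ s) (v : NNReal) :
    Represents (μ ∗ Measure.pi (fun _ : Fin n => gaussianReal 0 v)) (fp s (v/2 : ℝ)) := by
  intro α
  set γ := Measure.pi (fun _ : Fin n => gaussianReal 0 v) with hγ
  have hint : Integrable (fun x : Fin n → ℝ => ∏ i, x i ^ α i) (μ ∗ γ) := by
    have hm : Continuous (fun x : Fin n → ℝ => ∏ i, x i ^ α i) := by fun_prop
    unfold Measure.conv
    rw [integrable_map_measure hm.aestronglyMeasurable (by fun_prop)]
    have e : ((fun x : Fin n → ℝ => ∏ i, x i ^ α i) ∘ fun x : (Fin n → ℝ) × (Fin n → ℝ) => x.1 + x.2)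
        = fun z => ∑ k ∈ Fintype.piFinset (fun i => range (α i + 1)),
          (∏ i, z.1 i ^ (k i)) * (∏ i, z.2 i ^ (α i - k i)) * (∏ i, ((α i).choose (k i) : ℝ)) := by
      ext z
      simp only [Function.comp, Pi.add_apply, add_pow]
      rw [Finset.prod_univ_sum]
      simp only [Finset.prod_mul_distrib]
    rw [e]
    refine integrable_finsetSum _ fun k _ => Integrable.mul_const ?_ _
    refine Integrable.mul_prod (f := fun x : Fin n → ℝ => ∏ i, x i ^ (k i))
      (g := fun x : Fin n → ℝ => ∏ i, x i ^ (α i - k i)) (h k).1 ?_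
    exact Integrable.fintype_prod (f := fun i (y : ℝ) => y ^ (α i - k i)) (fun i => gm_int v _)
  refine ⟨hint, ?_⟩
  rw [integral_conv hint]
  have e : ∀ x : Fin n → ℝ, ∫ y, ∏ i, (x + y) i ^ α i ∂γ =
      ∑ β : (∀ i : Fin n, Fin (α i / 2 + 1)),
        (∏ i, ((α i).factorial : ℝ) /
        (((α i - 2 * (β i : ℕ)).factorial : ℝ) * (((β i : ℕ)).factorial : ℝ))) *
        (∏ i, x i ^ (α i - 2 * (β i : ℕ))) * (v/2 : ℝ) ^ (∑ i, (β i : ℕ)) := by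
    intro x
    simp only [Pi.add_apply]
    rw [hγ, integral_fintype_prod_eq_prod (fun i (y : ℝ) => (x i + y) ^ α i)]
    simp_rw [oneD]
    rw [Fintype.prod_sum]
    simp only [Finset.prod_mul_distrib, Finset.prod_pow_eq_pow_sum]
  simp_rw [e]
  rw [integral_finsetSum _ (fun β _ => ((h _).1.const_mul _).mul_const _)]
  unfold fp
  refine Finset.sum_congr rfl fun β _ => ?_
  rw [integral_mul_const, integral_const_mul, ← (h _).2]

lemma represents_finite {n : ℕ} {s : (Fin n → ℕ) → ℝ} {μ : Measure (Fin n → ℝ)}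
    (h : Represents μ s) : IsFiniteMeasure μ := by
  have := (h 0).1
  simp only [Pi.zero_apply, pow_zero, Finset.prod_const_one] at this
  rw [integrable_const_iff] at this
  simpa using this

lemma conv_inj {n : ℕ} {μ ν : Measure (Fin n → ℝ)} [IsFiniteMeasure μ] [IsFiniteMeasure ν]
    (v : NNReal) (h : μ ∗ Measure.pi (fun _ : Fin n => gaussianReal 0 v) =
      ν ∗ Measure.pi (fun _ : Fin n => gaussianReal 0 v)) : μ = ν := by
  apply Measure.ext_of_charFunDual
  ext L
  have h2 := congrArg (fun m => charFunDual m L) h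
  simp only [charFunDual_conv] at h2
  refine mul_right_cancel₀ ?_ h2
  rw [charFunDual_pi]
  refine Finset.prod_ne_zero_iff.2 fun i _ => ?_
  rw [IsGaussian.charFunDual_eq]
  exact Complex.exp_ne_zero _

end Aux

/-- If a full moment sequence `s` is indeterminate, then `𝔭_s(t)` is indeterminate
for every `t ≥ 0`. -/
theorem fp_indeterminate (n : ℕ) (s : (Fin n → ℕ) → ℝ)
    (hs : Indeterminate s) :
    ∀ t : ℝ, 0 ≤ t → Indeterminate (fp s t) := by
  intro t ht
  obtain ⟨μ, ν, hμ, hν, hne⟩ := hs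
  have := represents_finite hμ
  have := represents_finite hν
  have hv : (((2 * t).toNNReal : NNReal) : ℝ) / 2 = t := by
    rw [Real.coe_toNNReal _ (by linarith)]; ring
  have h1 := fp_represents hμ (2 * t).toNNReal
  have h2 := fp_represents hν (2 * t).toNNReal
  rw [hv] at h1 h2
  exact ⟨_, _, h1, h2, fun h => hne (conv_inj _ h)⟩
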